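/- Let T : E → F be an rmo-continuous linear operator between two Archimedean Riesz algebras. Then T is mo-bounded: for every order bounded subset B of E, the image T(B) is mo-bounded in F, i.e. for every w ∈ F_+ both sets w·T(B) and T(B)·w are order bounded in F. -/

import Mathlib

universe u

section RieszDefs

variable {X : Type u} [Lattice X] [AddCommGroup X] [Module ℝ X]

/-- A net `x : A → X` order converges to `x₀`:  there is a set `D` (the range of a
net `y_β ↓ 0`), downward directed with infimum `0`, such that for each `d ∈ D`
eventually `|x α - x₀| ≤ d`. -/
def OConv {A : Type u} [Preorder A] (x : A → X) (x₀ : X) : Prop :=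
  ∃ D : Set X, D.Nonempty ∧ DirectedOn (· ≥ ·) D ∧ IsGLB D 0 ∧
    ∀ d ∈ D, ∃ α₀ : A, ∀ α, α₀ ≤ α → |x α - x₀| ≤ d

/-- A net `x : A → X` relatively uniformly converges to `x₀`. -/
def RConv {A : Type u} [Preorder A] (x : A → X) (x₀ : X) : Prop :=
  ∃ u : X, 0 ≤ u ∧ ∀ n : ℕ, ∃ α₀ : A, ∀ α, α₀ ≤ α → |x α - x₀| ≤ ((n : ℝ) + 1)⁻¹ • u

end RieszDefs

/-- Archimedean Riesz space: `(1/n)u ↓ 0` for every `u ≥ 0`. -/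
def ArchRiesz (X : Type u) [Lattice X] [AddCommGroup X] [Module ℝ X] : Prop :=
  ∀ u : X, 0 ≤ u → IsGLB (Set.range fun n : ℕ => ((n : ℝ) + 1)⁻¹ • u) (0 : X)

/-- A set is order bounded if contained in some order interval. -/
def OrdBounded {X : Type u} [Preorder X] (B : Set X) : Prop :=
  ∃ a b : X, B ⊆ Set.Icc a b

section AlgDefs

variable {F : Type u} [NonUnitalRing F] [Lattice F] [Module ℝ F]

/-- Left multiplicative order convergence. -/
def MlOConv {A : Type u} [Preorder A] (x : A → F) (x₀ : F) : Prop :=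
  ∀ u : F, 0 ≤ u → OConv (fun α => u * |x α - x₀|) (0 : F)

/-- Right multiplicative order convergence. -/
def MrOConv {A : Type u} [Preorder A] (x : A → F) (x₀ : F) : Prop :=
  ∀ u : F, 0 ≤ u → OConv (fun α => |x α - x₀| * u) (0 : F)

/-- Multiplicative order convergence. -/
def MOConv {A : Type u} [Preorder A] (x : A → F) (x₀ : F) : Prop :=
  MlOConv x x₀ ∧ MrOConv x x₀

/-- Left multiplicative r-convergence. -/
def MlRConv {A : Type u} [Preorder A] (x : A → F) (x₀ : F) : Prop :=
  ∀ u : F, 0 ≤ u → RConv (fun α => u * |x α - x₀|) (0 : F)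

/-- Right multiplicative r-convergence. -/
def MrRConv {A : Type u} [Preorder A] (x : A → F) (x₀ : F) : Prop :=
  ∀ u : F, 0 ≤ u → RConv (fun α => |x α - x₀| * u) (0 : F)

/-- The net `z` is mo-Cauchy. -/
def MOCauchy {A : Type u} [Preorder A] (z : A → F) : Prop :=
  ∀ u : F, 0 ≤ u → ∃ D : Set F, D.Nonempty ∧ DirectedOn (· ≥ ·) D ∧ IsGLB D 0 ∧
    ∀ d ∈ D, ∃ α₀ : A, ∀ α₁, α₀ ≤ α₁ → ∀ α₂, α₀ ≤ α₂ →
      u * |z α₁ - z α₂| ≤ d ∧ |z α₁ - z α₂| * u ≤ d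

/-- The net `z` is m_l o-Cauchy. -/
def MlOCauchy {A : Type u} [Preorder A] (z : A → F) : Prop :=
  ∀ u : F, 0 ≤ u → ∃ D : Set F, D.Nonempty ∧ DirectedOn (· ≥ ·) D ∧ IsGLB D 0 ∧
    ∀ d ∈ D, ∃ α₀ : A, ∀ α₁, α₀ ≤ α₁ → ∀ α₂, α₀ ≤ α₂ →
      u * |z α₁ - z α₂| ≤ d

end AlgDefs

/-- The index set `ℕ × [-e, e]`, to be preordered by the natural number component only. -/
structure ScaledInterval {E : Type u} [Lattice E] [AddCommGroup E] (e : E) : Type u where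
  /-- the scale of the index -/
  scale : ℕ
  /-- the point of the order interval -/
  point : E
  abs_point_le : |point| ≤ e

instance {E : Type u} [Lattice E] [AddCommGroup E] (e : E) : Preorder (ScaledInterval e) :=
  Preorder.lift ScaledInterval.scale

instance {E : Type u} [Lattice E] [AddCommGroup E] (e : E) :
    IsDirected (ScaledInterval e) (· ≤ ·) :=
  ⟨fun p q => (le_total p.scale q.scale).elim (fun h => ⟨q, h, le_refl q.scale⟩)
    fun h => ⟨p, le_refl p.scale, h⟩⟩

section ScaledNet

variable {E : Type u} [Lattice E] [AddCommGroup E] [Module ℝ E]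

/-- The net `(n, x) ↦ x / (n + 1)` on `ℕ × [-e, e]`. -/
noncomputable def scaledNet (e : E) (p : ScaledInterval e) : E :=
  ((p.scale : ℝ) + 1)⁻¹ • p.point

theorem scaledNet_rConv [AddLeftMono E] [PosSMulMono ℝ E] {e : E} (he : 0 ≤ e) :
    RConv (scaledNet e) 0 := by
  have : IsOrderedAddMonoid E := { add_le_add_left := fun _ _ h c => add_le_add_left h c }
  refine ⟨e, he, fun n => ⟨⟨n, 0, by simpa using he⟩, fun p hp => ?_⟩⟩
  have hn : n ≤ p.scale := hp
  have hc : (0 : ℝ) ≤ ((p.scale : ℝ) + 1)⁻¹ := by positivity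
  obtain ⟨h₁, h₂⟩ := abs_le'.1 p.abs_point_le
  have hle : ((p.scale : ℝ) + 1)⁻¹ ≤ ((n : ℝ) + 1)⁻¹ := by gcongr
  refine le_trans ?_ (smul_le_smul_of_nonneg_right hle he)
  rw [sub_zero, scaledNet, abs_le', ← smul_neg]
  exact ⟨smul_le_smul_of_nonneg_left h₁ hc, smul_le_smul_of_nonneg_left h₂ hc⟩

/-- If a positive operator `L` makes `L |T x|` order convergent to `0` along the scaled net, then
`L ∘ T` is order bounded on `[-e, e]`. -/
theorem OConv.exists_abs_le_of_scaledNet {F : Type u} [Lattice F] [AddCommGroup F] [Module ℝ F]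
    [AddLeftMono F] [PosSMulMono ℝ F] {e : E} {T : E →ₗ[ℝ] F} {L : F →ₗ[ℝ] F}
    (hL : ∀ y, 0 ≤ y → 0 ≤ L y)
    (h : OConv (fun p : ScaledInterval e => L |T (scaledNet e p) - T 0|) 0) :
    ∃ c : F, ∀ x, |x| ≤ e → |L (T x)| ≤ c := by
  have hmono : ∀ y z, y ≤ z → L y ≤ L z := fun y z hyz => by
    simpa using hL (z - y) (sub_nonneg.2 hyz)
  obtain ⟨D, ⟨d, hd⟩, -, -, hD⟩ := h
  obtain ⟨p, hp⟩ := hD d hd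
  have hs : (0 : ℝ) < (p.scale : ℝ) + 1 := by positivity
  refine ⟨((p.scale : ℝ) + 1) • d, fun x hx => ?_⟩
  have hbound : L |((p.scale : ℝ) + 1)⁻¹ • T x| ≤ d := by
    simpa [scaledNet] using (le_abs_self _).trans (hp ⟨p.scale, x, hx⟩ (le_refl p.scale))
  have key : ∀ y : F, ((p.scale : ℝ) + 1)⁻¹ • y ≤ |((p.scale : ℝ) + 1)⁻¹ • T x| →
      L y ≤ ((p.scale : ℝ) + 1) • d := fun y hy => by
    have := smul_le_smul_of_nonneg_left ((hmono _ _ hy).trans hbound) hs.le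
    rwa [map_smul, smul_inv_smul₀ hs.ne'] at this
  rw [abs_le', ← map_neg]
  exact ⟨key _ (le_abs_self _), key _ (by rw [smul_neg]; exact neg_le_abs _)⟩

end ScaledNet

theorem ordBounded_of_abs_le {F : Type u} [Lattice F] [AddCommGroup F] [AddLeftMono F]
    {S : Set F} {c : F} (h : ∀ y ∈ S, |y| ≤ c) : OrdBounded S :=
  ⟨-c, c, fun y hy => ⟨neg_le.1 ((neg_le_abs y).trans (h y hy)), (le_abs_self y).trans (h y hy)⟩⟩

/-- Every rmo-continuous operator between Archimedean Riesz algebras is mo-bounded. -/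
theorem rmoCont_implies_moBounded {E F : Type u}
    [NonUnitalRing E] [Lattice E] [Module ℝ E]
    [CovariantClass E E (· + ·) (· ≤ ·)] [PosSMulMono ℝ E]
    [IsScalarTower ℝ E E] [SMulCommClass ℝ E E]
    (hmulE : ∀ x y : E, 0 ≤ x → 0 ≤ y → 0 ≤ x * y)
    (hArchE : ArchRiesz E)
    [NonUnitalRing F] [Lattice F] [Module ℝ F]
    [CovariantClass F F (· + ·) (· ≤ ·)] [PosSMulMono ℝ F]
    [IsScalarTower ℝ F F] [SMulCommClass ℝ F F]
    (hmulF : ∀ x y : F, 0 ≤ x → 0 ≤ y → 0 ≤ x * y)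
    (hArchF : ArchRiesz F)
    (T : E →ₗ[ℝ] F)
    (hT : ∀ (A : Type u) [Preorder A] [IsDirected A (· ≤ ·)] [Nonempty A],
      ∀ (x : A → E) (x₀ : E), RConv x x₀ → MOConv (fun α => T (x α)) (T x₀)) :
    ∀ B : Set E, OrdBounded B → ∀ w : F, 0 ≤ w →
      OrdBounded ((fun y => w * y) '' (T '' B)) ∧
      OrdBounded ((fun y => y * w) '' (T '' B)) := by
  rintro B ⟨a, b, hB⟩ w hw
  have he : 0 ≤ |a| ⊔ |b| := (abs_nonneg a).trans le_sup_left
  have hBe : ∀ x ∈ B, |x| ≤ |a| ⊔ |b| := fun x hx => abs_le'.2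
    ⟨(hB hx).2.trans ((le_abs_self b).trans le_sup_right),
      (neg_le_neg_iff.2 (hB hx).1).trans ((neg_le_abs a).trans le_sup_left)⟩
  have : Nonempty (ScaledInterval (|a| ⊔ |b|)) := ⟨⟨0, 0, by simpa using he⟩⟩
  obtain ⟨hl, hr⟩ := hT _ _ _ (scaledNet_rConv he)
  obtain ⟨c, hc⟩ := OConv.exists_abs_le_of_scaledNet (L := LinearMap.mulLeft ℝ w)
    (fun y hy => hmulF w y hw hy) (hl w hw)
  obtain ⟨c', hc'⟩ := OConv.exists_abs_le_of_scaledNet (L := LinearMap.mulRight ℝ w)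
    (fun y hy => hmulF y w hy hw) (hr w hw)
  constructor
  · refine ordBounded_of_abs_le (c := c) ?_
    rintro _ ⟨_, ⟨x, hx, rfl⟩, rfl⟩
    exact hc x (hBe x hx)
  · refine ordBounded_of_abs_le (c := c') ?_
    rintro _ ⟨_, ⟨x, hx, rfl⟩, rfl⟩
    exact hc' x (hBe x hx)
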